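/- Let x_1, …, x_n ∈ ℝ^d and Y_1, …, Y_n ∈ {0,1}. Define the logistic log-likelihood F : ℝ^d → ℝ by F(z) = Σ_{i=1}^n Y_i x_iᵀ z − Σ_{i=1}^n log(1 + exp(x_iᵀ z)) and the likelihood ℓ(z) = exp(F(z)). Then 0 < ℓ(z) ≤ 1 for all z ∈ ℝ^d, for every nonempty subset u ⊆ {1,…,d} the mixed partial derivative D_u F is bounded on ℝ^d, and for every subset u ⊆ {1,…,d} the mixed partial derivative D_u ℓ is bounded on ℝ^d. Consequently, ℓ satisfies the QMC-friendly boundary growth condition. -/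

import Mathlib

open MeasureTheory Filter

/-- The standard normal CDF `Φ(t) = ∫_{-∞}^t (2π)^{-1/2} e^{-s²/2} ds`. -/
noncomputable def stdNormalCDF (t : ℝ) : ℝ :=
  ∫ s in Set.Iic t, (Real.sqrt (2 * Real.pi))⁻¹ * Real.exp (-s ^ 2 / 2)

/-- The mixed partial derivative `D_v f` of `f : ℝ^d → ℝ`, taken exactly once with
respect to each coordinate `z_i` with `i ∈ v` (and `D_∅ f = f`). -/
noncomputable def mixedPartial {d : ℕ} (f : (Fin d → ℝ) → ℝ) (v : Finset (Fin d)) :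
    (Fin d → ℝ) → ℝ :=
  fun z => iteratedFDeriv ℝ v.card f z
    (fun j => Pi.single ((v.sort (· ≤ ·)).get ⟨j.1, by simp⟩) 1)

/-- `G : ℝ^d → ℝ` satisfies the QMC-friendly boundary growth condition if for every tuple
of positive reals `(B_1, …, B_d)` there is a constant `B < ∞` with
`|(D_v G)(z)| ≤ B ∏_i (1 - Φ(|z_i|))^{-B_i}` for all `z` and all `v ⊆ {1,…,d}`. -/
def BoundaryGrowthCondition {d : ℕ} (G : (Fin d → ℝ) → ℝ) : Prop :=
  ∀ B : Fin d → ℝ, (∀ i, 0 < B i) →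
    ∃ C : ℝ, ∀ (v : Finset (Fin d)) (z : Fin d → ℝ),
      |mixedPartial G v z| ≤ C * ∏ i, (1 - stdNormalCDF |z i|) ^ (-(B i))

theorem stdNormalCDF_eq_setIntegral_gaussianPDFReal (t : ℝ) :
    stdNormalCDF t = ∫ s in Set.Iic t, ProbabilityTheory.gaussianPDFReal 0 1 s := by
  simp [stdNormalCDF, ProbabilityTheory.gaussianPDFReal]

theorem stdNormalCDF_nonneg (t : ℝ) : 0 ≤ stdNormalCDF t := by
  rw [stdNormalCDF_eq_setIntegral_gaussianPDFReal]
  exact integral_nonneg fun s => ProbabilityTheory.gaussianPDFReal_nonneg 0 1 s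

theorem stdNormalCDF_lt_one (t : ℝ) : stdNormalCDF t < 1 := by
  have hint := ProbabilityTheory.integrable_gaussianPDFReal 0 1
  have hsupp : Function.support (ProbabilityTheory.gaussianPDFReal 0 1) = Set.univ :=
    Set.eq_univ_of_forall fun s =>
      (ProbabilityTheory.gaussianPDFReal_pos 0 1 s one_ne_zero).ne'
  have hpos : 0 < ∫ s in (Set.Iic t)ᶜ, ProbabilityTheory.gaussianPDFReal 0 1 s := by
    rw [setIntegral_pos_iff_support_of_nonneg_ae
      (ae_of_all _ fun s => ProbabilityTheory.gaussianPDFReal_nonneg 0 1 s) hint.integrableOn,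
      hsupp]
    simp
  have hsum := integral_add_compl (measurableSet_Iic (a := t)) hint
  rw [ProbabilityTheory.integral_gaussianPDFReal_eq_one 0 one_ne_zero] at hsum
  rw [stdNormalCDF_eq_setIntegral_gaussianPDFReal]
  linarith

theorem one_le_prod_one_sub_stdNormalCDF_rpow_neg {d : ℕ} {B : Fin d → ℝ}
    (hB : ∀ i, 0 < B i) (z : Fin d → ℝ) :
    1 ≤ ∏ i, (1 - stdNormalCDF |z i|) ^ (-(B i)) := by
  refine Finset.one_le_prod fun i _ => ?_
  exact Real.one_le_rpow_of_pos_of_le_one_of_nonpos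
    (sub_pos.2 (stdNormalCDF_lt_one _)) (sub_le_self _ (stdNormalCDF_nonneg _))
    (neg_nonpos.2 (hB i).le)

theorem boundaryGrowthCondition_of_bounded {d : ℕ} {G : (Fin d → ℝ) → ℝ}
    (hG : ∀ u : Finset (Fin d), ∃ C : ℝ, ∀ z, |mixedPartial G u z| ≤ C) :
    BoundaryGrowthCondition G := by
  intro B hB
  choose C hC using hG
  have hC0 (u : Finset (Fin d)) : 0 ≤ C u := (abs_nonneg _).trans (hC u 0)
  refine ⟨∑ u, C u, fun v z => ?_⟩
  calc |mixedPartial G v z| ≤ C v := hC v z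
    _ ≤ ∑ u, C u := Finset.single_le_sum (fun u _ => hC0 u) (Finset.mem_univ v)
    _ ≤ _ := le_mul_of_one_le_right (Finset.sum_nonneg fun u _ => hC0 u)
      (one_le_prod_one_sub_stdNormalCDF_rpow_neg hB z)

theorem abs_mixedPartial_le {d : ℕ} (f : (Fin d → ℝ) → ℝ) (v : Finset (Fin d))
    (z : Fin d → ℝ) : |mixedPartial f v z| ≤ ‖iteratedFDeriv ℝ v.card f z‖ := by
  have h := (iteratedFDeriv ℝ v.card f z).le_opNorm
    (fun j => Pi.single ((v.sort (· ≤ ·)).get ⟨j.1, by simp⟩) 1)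
  simpa [mixedPartial, Pi.norm_single] using h

/-- If the derivative of `f` is `p ∘ f` for a polynomial `p`,
all derivatives of `f` are polynomials in `f`. -/
theorem exists_iteratedDeriv_eq_polynomial_eval {f : ℝ → ℝ} {p : Polynomial ℝ}
    (hf : ∀ s, HasDerivAt f (p.eval (f s)) s) (k : ℕ) :
    ∃ q : Polynomial ℝ, ∀ s, iteratedDeriv k f s = q.eval (f s) := by
  induction k with
  | zero => exact ⟨Polynomial.X, by simp⟩
  | succ k ih =>
    obtain ⟨q, hq⟩ := ih
    refine ⟨q.derivative * p, fun s => ?_⟩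
    rw [iteratedDeriv_succ, funext hq, Polynomial.eval_mul]
    exact ((q.hasDerivAt (f s)).comp s (hf s)).deriv

theorem exists_abs_iteratedDeriv_sigmoid_le (k : ℕ) :
    ∃ C : ℝ, ∀ s, |iteratedDeriv k Real.sigmoid s| ≤ C := by
  obtain ⟨q, hq⟩ := exists_iteratedDeriv_eq_polynomial_eval
    (f := Real.sigmoid) (p := Polynomial.X * (1 - Polynomial.X))
    (fun s => by simpa using Real.hasDerivAt_sigmoid s) k
  obtain ⟨C, hC⟩ := (isCompact_Icc (a := (0 : ℝ)) (b := 1)).exists_bound_of_continuousOn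
    q.continuous.continuousOn
  exact ⟨C, fun s => by
    simpa [hq s] using hC _ ⟨Real.sigmoid_nonneg s, Real.sigmoid_le_one s⟩⟩

theorem deriv_log_sigmoid : deriv (fun s => Real.log (Real.sigmoid s)) =
    fun s => 1 - Real.sigmoid s := by
  funext s
  rw [((Real.hasDerivAt_sigmoid s).log (Real.sigmoid_pos s).ne').deriv]
  field_simp [(Real.sigmoid_pos s).ne']

theorem exists_abs_iteratedDeriv_log_sigmoid_le {k : ℕ} (hk : k ≠ 0) :
    ∃ C : ℝ, ∀ s, |iteratedDeriv k (fun s => Real.log (Real.sigmoid s)) s| ≤ C := by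
  obtain ⟨k, rfl⟩ := Nat.exists_eq_succ_of_ne_zero hk
  rw [Nat.succ_eq_add_one, iteratedDeriv_succ', deriv_log_sigmoid]
  rcases Nat.eq_zero_or_pos k with rfl | hk'
  · refine ⟨1, fun s => ?_⟩
    rw [iteratedDeriv_zero, abs_le]
    constructor <;> linarith [Real.sigmoid_nonneg s, Real.sigmoid_le_one s]
  · obtain ⟨C, hC⟩ := exists_abs_iteratedDeriv_sigmoid_le k
    refine ⟨C, fun s => ?_⟩
    rw [iteratedDeriv_const_sub hk', iteratedDeriv_neg, abs_neg]
    exact hC s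

section BoundedDerivatives

variable {E : Type*} [NormedAddCommGroup E] [NormedSpace ℝ E]

theorem exists_norm_iteratedFDeriv_comp_le {g : ℝ → ℝ} {k : ℕ} (hg : ContDiff ℝ k g)
    (hb : ∃ C : ℝ, ∀ s, |iteratedDeriv k g s| ≤ C) (L : E →L[ℝ] ℝ) :
    ∃ C : ℝ, ∀ z, ‖iteratedFDeriv ℝ k (fun z => g (L z)) z‖ ≤ C := by
  obtain ⟨C, hC⟩ := hb
  refine ⟨C * ‖L‖ ^ k, fun z => ?_⟩
  have h : iteratedFDeriv ℝ k (fun z => g (L z)) z = _ :=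
    L.iteratedFDeriv_comp_right hg z le_rfl
  rw [h]
  refine (ContinuousMultilinearMap.norm_compContinuousLinearMap_le _ _).trans ?_
  rw [norm_iteratedFDeriv_eq_norm_iteratedDeriv, Finset.prod_const, Finset.card_univ,
    Fintype.card_fin]
  exact mul_le_mul_of_nonneg_right (hC _) (by positivity)

theorem exists_norm_iteratedFDeriv_sum_le {ι : Type*} {s : Finset ι} {f : ι → E → ℝ} {k : ℕ}
    (hf : ∀ i ∈ s, ContDiff ℝ k (f i))
    (hb : ∀ i, ∃ C : ℝ, ∀ z, ‖iteratedFDeriv ℝ k (f i) z‖ ≤ C) :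
    ∃ C : ℝ, ∀ z, ‖iteratedFDeriv ℝ k (fun z => ∑ i ∈ s, f i z) z‖ ≤ C := by
  choose C hC using hb
  refine ⟨∑ i ∈ s, C i, fun z => ?_⟩
  rw [iteratedFDeriv_sum hf, Finset.sum_apply]
  exact norm_sum_le_of_le _ fun i _ => hC i z

theorem exists_norm_iteratedFDeriv_prod_le {ι : Type*} {s : Finset ι} {f : ι → E → ℝ} {k : ℕ}
    (hf : ∀ i ∈ s, ContDiff ℝ k (f i))
    (hb : ∀ i m, ∃ C : ℝ, ∀ z, ‖iteratedFDeriv ℝ m (f i) z‖ ≤ C) :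
    ∃ C : ℝ, ∀ z, ‖iteratedFDeriv ℝ k (fun z => ∏ i ∈ s, f i z) z‖ ≤ C := by
  classical
  choose C hC using hb
  exact ⟨_, fun z => (norm_iteratedFDeriv_prod_le hf le_rfl).trans <|
    Finset.sum_le_sum fun p _ => mul_le_mul_of_nonneg_left
      (Finset.prod_le_prod (fun _ _ => norm_nonneg _)
        fun j _ => hC j ((p : Multiset ι).count j) z) (Nat.cast_nonneg _)⟩

end BoundedDerivatives

theorem log_sigmoid_eq (s : ℝ) : Real.log (Real.sigmoid s) = s - Real.log (1 + Real.exp s) := by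
  have h : Real.sigmoid s = Real.exp s / (1 + Real.exp s) := by
    rw [Real.sigmoid_def, Real.exp_neg]
    field_simp
    ring
  rw [h, Real.log_div (Real.exp_pos s).ne' (by positivity), Real.log_exp]

theorem log_sigmoid_neg_eq (s : ℝ) :
    Real.log (Real.sigmoid (-s)) = -Real.log (1 + Real.exp s) := by
  rw [Real.sigmoid_def, neg_neg, Real.log_inv]

/-- The signed linear form `z ↦ (2 * y - 1) * xᵀz`, so that an observation `y ∈ {0,1}` with covariate
`x` has likelihood `sigmoid ((2 * y - 1) * xᵀz)`. -/
noncomputable def signedLinearForm {d : ℕ} (x : Fin d → ℝ) (y : ℝ) : (Fin d → ℝ) →L[ℝ] ℝ :=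
  (2 * y - 1) • ∑ j, x j • ContinuousLinearMap.proj j

theorem log_sigmoid_signedLinearForm {d : ℕ} (x z : Fin d → ℝ) {y : ℝ} (hy : y = 0 ∨ y = 1) :
    Real.log (Real.sigmoid (signedLinearForm x y z)) =
      y * ∑ j, x j * z j - Real.log (1 + Real.exp (∑ j, x j * z j)) := by
  have h : signedLinearForm x y z = (2 * y - 1) * ∑ j, x j * z j := by
    simp [signedLinearForm]
  rw [h]
  rcases hy with rfl | rfl
  · simpa using log_sigmoid_neg_eq _
  · norm_num [log_sigmoid_eq]

/-- the logistic likelihood `ℓ(z) = exp(F(z))` satisfies `0 < ℓ ≤ 1`, all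
mixed partial derivatives of `F` (for nonempty `u`) and of `ℓ` are bounded, and `ℓ`
satisfies the QMC-friendly boundary growth condition. -/
theorem logistic_likelihood_boundary_growth
    {d n : ℕ} (x : Fin n → Fin d → ℝ) (Y : Fin n → ℝ)
    (hY : ∀ i, Y i = 0 ∨ Y i = 1)
    (F ℓ : (Fin d → ℝ) → ℝ)
    (hFdef : ∀ z, F z = (∑ i, Y i * ∑ j, x i j * z j) -
      ∑ i, Real.log (1 + Real.exp (∑ j, x i j * z j)))
    (hldef : ∀ z, ℓ z = Real.exp (F z)) :
    (∀ z, 0 < ℓ z ∧ ℓ z ≤ 1) ∧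
    (∀ u : Finset (Fin d), u ≠ ∅ → ∃ C : ℝ, ∀ z, |mixedPartial F u z| ≤ C) ∧
    (∀ u : Finset (Fin d), ∃ C : ℝ, ∀ z, |mixedPartial ℓ u z| ≤ C) ∧
    BoundaryGrowthCondition ℓ := by
  have hF : F = fun z => ∑ i, Real.log (Real.sigmoid (signedLinearForm (x i) (Y i) z)) := by
    funext z
    rw [hFdef, ← Finset.sum_sub_distrib]
    exact Finset.sum_congr rfl fun i _ => (log_sigmoid_signedLinearForm (x i) z (hY i)).symm
  have hl : ℓ = fun z => ∏ i, Real.sigmoid (signedLinearForm (x i) (Y i) z) := by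
    funext z
    rw [hldef, hF, Real.exp_sum]
    exact Finset.prod_congr rfl fun i _ => Real.exp_log (Real.sigmoid_pos _)
  have hsig (k : ℕ) : ContDiff ℝ k Real.sigmoid := contDiff_sigmoid.of_le le_top
  have hlog (k : ℕ) : ContDiff ℝ k fun s => Real.log (Real.sigmoid s) :=
    (hsig k).log fun s => (Real.sigmoid_pos s).ne'
  have hbdd (u : Finset (Fin d)) : ∃ C : ℝ, ∀ z, |mixedPartial ℓ u z| ≤ C := by
    obtain ⟨C, hC⟩ := exists_norm_iteratedFDeriv_prod_le (s := Finset.univ) (k := u.card)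
      (f := fun i z => Real.sigmoid (signedLinearForm (x i) (Y i) z))
      (fun i _ => (hsig _).comp (ContinuousLinearMap.contDiff _))
      (fun i m => exists_norm_iteratedFDeriv_comp_le (hsig m)
        (exists_abs_iteratedDeriv_sigmoid_le m) _)
    exact ⟨C, fun z => (abs_mixedPartial_le ℓ u z).trans (by rw [hl]; exact hC z)⟩
  refine ⟨fun z => ?_, fun u hu => ?_, hbdd, boundaryGrowthCondition_of_bounded hbdd⟩
  · rw [hl]
    exact ⟨Finset.prod_pos fun i _ => Real.sigmoid_pos _,
      Finset.prod_le_one (fun i _ => Real.sigmoid_nonneg _) fun i _ => Real.sigmoid_le_one _⟩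
  · obtain ⟨C, hC⟩ := exists_norm_iteratedFDeriv_sum_le (s := Finset.univ) (k := u.card)
      (f := fun i z => Real.log (Real.sigmoid (signedLinearForm (x i) (Y i) z)))
      (fun i _ => (hlog _).comp (ContinuousLinearMap.contDiff _))
      (fun i => exists_norm_iteratedFDeriv_comp_le (hlog _)
        (exists_abs_iteratedDeriv_log_sigmoid_le (Finset.card_ne_zero.2
          (Finset.nonempty_iff_ne_empty.2 hu))) _)
    exact ⟨C, fun z => (abs_mixedPartial_le F u z).trans (by rw [hF]; exact hC z)⟩
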